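/- arXiv:2006.12403 — 3 statements merged into one kernel-verified Lean document; each statement's English description precedes it below -/
import Mathlib

section
/- Let (V_ℝ, W, F) be a real mixed Hodge structure. If it admits a real splitting, i.e., a bigrading V_ℂ = ⊕_{p,q} J^{p,q} with F^p = ⊕_{r ≥ p, s} J^{r,s}, (W_k)_ℂ = ⊕_{r+s ≤ k} J^{r,s}, and conjugation(J^{p,q}) = J^{q,p}, then necessarily J^{p,q} = F^p ∩ conjugate(F^q) ∩ (W_{p+q})_ℂ; in particular the real splitting is unique. -/
/-- A real structure (antilinear conjugation) on a complex vector space. -/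
structure ConjOp (V : Type*) [AddCommGroup V] [Module ℂ V] where
  σ : V → V
  map_add : ∀ x y, σ (x + y) = σ x + σ y
  map_smul : ∀ (c : ℂ) (x : V), σ (c • x) = (starRingEnd ℂ) c • σ x
  invol : ∀ x, σ (σ x) = x

variable {V : Type*} [AddCommGroup V] [Module ℂ V]

/-- The conjugate `σ(F)` of a complex subspace (as a complex subspace). -/
def conjSub (c : ConjOp V) (F : Submodule ℂ V) : Submodule ℂ V where
  carrier := {v | c.σ v ∈ F}
  add_mem' := fun {a b} ha hb => by
    show c.σ (a + b) ∈ F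
    rw [c.map_add]; exact F.add_mem ha hb
  zero_mem' := by
    show c.σ 0 ∈ F
    have h : c.σ ((0 : ℂ) • (0 : V)) = (starRingEnd ℂ) 0 • c.σ 0 := c.map_smul 0 0
    simp only [zero_smul, map_zero] at h
    rw [h]; exact F.zero_mem
  smul_mem' := fun r a ha => by
    show c.σ (r • a) ∈ F
    rw [c.map_smul]; exact F.smul_mem _ ha

/-- The `l`-th graded piece `Gr_l^W V = W_l / W_{l-1}`. -/
abbrev GrW (W : ℤ → Submodule ℂ V) (l : ℤ) :=
  ↥(W l) ⧸ ((W (l - 1)).comap (W l).subtype)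

/-- The filtration induced by a subspace `F'` on the graded piece `Gr_l^W V`. -/
def inducedFil (W : ℤ → Submodule ℂ V) (l : ℤ) (F' : Submodule ℂ V) :
    Submodule ℂ (GrW W l) :=
  Submodule.map ((W (l - 1)).comap (W l).subtype).mkQ (F'.comap (W l).subtype)

/-- `(V, W, F)` (with conjugation `c`) is a real mixed Hodge structure: the
filtrations are finite, `W` is real, and the filtrations induced by `F` and
`F̄` on each `Gr_l^W V` are `l`-opposed (i.e. `Gr_F^p Gr_F̄^q Gr_l^W V = 0`
whenever `p + q ≠ l`). -/
def IsMHS (c : ConjOp V) (W F : ℤ → Submodule ℂ V) : Prop :=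
  Monotone W ∧ Antitone F ∧
  (∃ a : ℤ, ∀ k ≤ a, W k = ⊥) ∧ (∃ b : ℤ, ∀ k, b ≤ k → W k = ⊤) ∧
  (∃ a' : ℤ, ∀ p, a' ≤ p → F p = ⊥) ∧ (∃ b' : ℤ, ∀ p ≤ b', F p = ⊤) ∧
  (∀ (k : ℤ) (v : V), v ∈ W k → c.σ v ∈ W k) ∧
  (∀ l p : ℤ,
    inducedFil W l (F p) ⊓ inducedFil W l (conjSub c (F (l + 1 - p))) = ⊥ ∧
    inducedFil W l (F p) ⊔ inducedFil W l (conjSub c (F (l + 1 - p))) = ⊤)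

/-- A bigrading `V_ℂ = ⊕ J^{p,q}` of a filtered vector space:
`F^p = ⊕_{r ≥ p, s} J^{r,s}` and `(W_k)_ℂ = ⊕_{r+s ≤ k} J^{r,s}`. -/
def IsBigrading (W F : ℤ → Submodule ℂ V) (J : ℤ × ℤ → Submodule ℂ V) : Prop :=
  DirectSum.IsInternal J ∧
  (∀ p : ℤ, F p = ⨆ rs : ℤ × ℤ, ⨆ _ : p ≤ rs.1, J rs) ∧
  (∀ k : ℤ, W k = ⨆ rs : ℤ × ℤ, ⨆ _ : rs.1 + rs.2 ≤ k, J rs)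

theorem comp_zero_of_mem_iSup (J : ℤ × ℤ → Submodule ℂ V) (hJ : DirectSum.IsInternal J)
    (P : ℤ × ℤ → Prop) (v : V) (hv : v ∈ ⨆ rs : ℤ × ℤ, ⨆ _ : P rs, J rs)
    (i : ℤ × ℤ) (hi : ¬ P i) :
    (LinearEquiv.ofBijective (DirectSum.coeLinearMap J) hJ).symm v i = 0 := by
  have hle : (⨆ rs : ℤ × ℤ, ⨆ _ : P rs, J rs) ≤
      LinearMap.ker ((DirectSum.component ℂ (ℤ × ℤ) (fun k => J k) i).comp
        (LinearEquiv.ofBijective (DirectSum.coeLinearMap J) hJ).symm.toLinearMap) := by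
    refine iSup_le fun rs => iSup_le fun hP x hx => ?_
    have hne : rs ≠ i := fun h => hi (h ▸ hP)
    have hx' : (LinearEquiv.ofBijective (DirectSum.coeLinearMap J) hJ).symm x =
        DirectSum.lof ℂ (ℤ × ℤ) (fun k => J k) rs ⟨x, hx⟩ := by
      rw [LinearEquiv.symm_apply_eq]
      exact (DirectSum.coeLinearMap_lof J rs ⟨x, hx⟩).symm
    rw [LinearMap.mem_ker, LinearMap.comp_apply]
    change DirectSum.component ℂ (ℤ × ℤ) (fun k => J k) i
      ((LinearEquiv.ofBijective (DirectSum.coeLinearMap J) hJ).symm x) = 0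
    rw [hx']
    exact DirectSum.of_eq_of_ne _ _ _ hne.symm
  exact hle hv

theorem mem_of_comp_zero (J : ℤ × ℤ → Submodule ℂ V) (hJ : DirectSum.IsInternal J)
    (v : V) (i : ℤ × ℤ)
    (h : ∀ j, j ≠ i → (LinearEquiv.ofBijective (DirectSum.coeLinearMap J) hJ).symm v j = 0) :
    v ∈ J i := by
  set e := LinearEquiv.ofBijective (DirectSum.coeLinearMap J) hJ with he
  have h1 : e.symm v = DirectSum.lof ℂ (ℤ × ℤ) (fun k => J k) i (e.symm v i) := by
    refine DFinsupp.ext fun j => ?_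
    by_cases hj : j = i
    · subst hj
      exact (DirectSum.of_eq_same (β := fun k => J k) j (e.symm v j)).symm
    · rw [h j hj]
      exact (DirectSum.of_eq_of_ne (β := fun k => J k) i j (e.symm v i) hj).symm
  rw [LinearEquiv.symm_apply_eq] at h1
  have h2 : e (DirectSum.lof ℂ (ℤ × ℤ) (fun k => J k) i (e.symm v i)) = (e.symm v i : V) :=
    DirectSum.coeLinearMap_lof J i (e.symm v i)
  rw [h1, h2]
  exact (e.symm v i).2

/-- If a real mixed Hodge structure admits a real splitting,
i.e. a bigrading `{J^{p,q}}` with `conj(J^{p,q}) = J^{q,p}`, then necessarily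
`J^{p,q} = F^p ∩ conj(F^q) ∩ (W_{p+q})_ℂ`; in particular the real splitting is
unique. -/
theorem real_splitting_is_unique
    [FiniteDimensional ℂ V] (c : ConjOp V) (W F : ℤ → Submodule ℂ V)
    (hmhs : IsMHS c W F)
    (J : ℤ × ℤ → Submodule ℂ V) (hJ : IsBigrading W F J)
    (hsym : ∀ (p q : ℤ) (v : V), v ∈ J (p, q) → c.σ v ∈ J (q, p)) :
    ∀ (p q : ℤ) (v : V),
      v ∈ J (p, q) ↔ v ∈ F p ∧ c.σ v ∈ F q ∧ v ∈ W (p + q) := by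
  obtain ⟨hint, hF, hW⟩ := hJ
  intro p q v
  constructor
  · intro hv
    refine ⟨?_, ?_, ?_⟩
    · rw [hF]
      exact Submodule.mem_iSup_of_mem (p, q) (Submodule.mem_iSup_of_mem le_rfl hv)
    · rw [hF]
      exact Submodule.mem_iSup_of_mem (q, p) (Submodule.mem_iSup_of_mem le_rfl (hsym p q v hv))
    · rw [hW]
      exact Submodule.mem_iSup_of_mem (p, q) (Submodule.mem_iSup_of_mem le_rfl hv)
  · rintro ⟨h1, h2, h3⟩
    have hle : F q ≤ conjSub c (⨆ rs : ℤ × ℤ, ⨆ _ : q ≤ rs.2, J rs) := by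
      rw [hF]
      refine iSup_le fun rs => iSup_le fun hq x hx => ?_
      exact Submodule.mem_iSup_of_mem (rs.2, rs.1)
        (Submodule.mem_iSup_of_mem hq (hsym rs.1 rs.2 x hx))
    have h2' : c.σ (c.σ v) ∈ (⨆ rs : ℤ × ℤ, ⨆ _ : q ≤ rs.2, J rs) := hle h2
    rw [c.invol] at h2'
    rw [hF] at h1
    rw [hW] at h3
    refine mem_of_comp_zero J hint v (p, q) fun j hj => ?_
    by_cases a : p ≤ j.1
    · by_cases b : q ≤ j.2
      · refine comp_zero_of_mem_iSup J hint _ v h3 j fun d => hj ?_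
        ext
        · show j.1 = p
          omega
        · show j.2 = q
          omega
      · exact comp_zero_of_mem_iSup J hint _ v h2' j b
    · exact comp_zero_of_mem_iSup J hint _ v h1 j a
end

section
/- A real mixed Hodge structure (V, W, F) admits a bigrading {J^{p,q}} with conjugate(J^{p,q}) = J^{q,p} if and only if there exists a semisimple endomorphism T of the real vector space V with integer eigenvalues such that the l-eigenspaces split the weight filtration W and T(F^p) ⊆ F^p for all p. -/
variable {V : Type*} [AddCommGroup V] [Module ℂ V]

theorem aux_le_eq {ι : Type*} (A E : ι → Submodule ℂ V) (hE : iSupIndep E)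
    (hle : ∀ i, A i ≤ E i) (htop : ⨆ i, A i = ⊤) (i : ι) : A i = E i := by
  apply le_antisymm (hle i)
  intro x hx
  have h1 : x ∈ A i ⊔ ⨆ j, ⨆ _ : j ≠ i, A j := by
    have : (⊤ : Submodule ℂ V) ≤ A i ⊔ ⨆ j, ⨆ _ : j ≠ i, A j := by
      rw [← htop]
      refine iSup_le fun j => ?_
      by_cases h : j = i
      · subst h; exact le_sup_left
      · exact le_sup_of_le_right (le_iSup₂_of_le j h le_rfl)
    exact this trivial
  obtain ⟨y, hy, z, hz, rfl⟩ := Submodule.mem_sup.1 h1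
  have hz' : z ∈ ⨆ j, ⨆ _ : j ≠ i, E j := (iSup₂_mono fun j _ => hle j) hz
  have hzE : z ∈ E i := by
    have := (E i).sub_mem hx (hle i hy)
    simpa using this
  have : z = 0 := Submodule.disjoint_def.1 (hE i) z hzE hz'
  simpa [this] using hy

theorem aux_intEig_indep (T : Module.End ℂ V) :
    iSupIndep (fun l : ℤ => Module.End.eigenspace T (l : ℂ)) :=
  (Module.End.eigenspaces_iSupIndep T).comp Int.cast_injective

/-- An invariant subspace is the sum of its intersections with the eigenspaces. -/
theorem aux_inv [FiniteDimensional ℂ V] (T : Module.End ℂ V)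
    (htop : ⨆ l : ℤ, Module.End.eigenspace T (l : ℂ) = ⊤)
    (P : Submodule ℂ V) (hP : ∀ v ∈ P, T v ∈ P) :
    P ≤ ⨆ l : ℤ, P ⊓ Module.End.eigenspace T (l : ℂ) := by
  have h := Submodule.inf_iSup_genEigenspace (f := T) (p := P) hP 1
  have h2 : ⨆ μ : ℂ, Module.End.genEigenspace T μ 1 = ⊤ := by
    rw [eq_top_iff, ← htop]
    exact iSup_le fun l => le_iSup (fun μ : ℂ => Module.End.genEigenspace T μ 1) (l : ℂ)
  rw [h2, inf_top_eq] at h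
  rw [h]
  refine iSup_le fun μ => ?_
  by_cases hμ : ∃ l : ℤ, (l : ℂ) = μ
  · obtain ⟨l, rfl⟩ := hμ
    rw [← h]
    exact le_iSup (fun l : ℤ => P ⊓ Module.End.eigenspace T (l : ℂ)) l
  · have hd := Module.End.eigenspaces_iSupIndep T μ
    have ht : ⨆ j, ⨆ _ : j ≠ μ, Module.End.eigenspace T j = ⊤ := by
      rw [eq_top_iff, ← htop]
      exact iSup_le fun l => le_iSup₂_of_le (l : ℂ) (fun h => hμ ⟨l, h⟩) le_rfl
    rw [ht, disjoint_top] at hd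
    have : Module.End.genEigenspace T μ 1 = ⊥ := hd
    rw [this]; simp

theorem aux_forward [FiniteDimensional ℂ V] (c : ConjOp V) (W F : ℤ → Submodule ℂ V)
    (J : ℤ × ℤ → Submodule ℂ V) (hJ : IsBigrading W F J)
    (hc : ∀ (p q : ℤ) (v : V), v ∈ J (p, q) → c.σ v ∈ J (q, p)) :
    ∃ T : Module.End ℂ V,
        (∀ v : V, c.σ (T v) = T (c.σ v)) ∧
        DirectSum.IsInternal (fun l : ℤ => Module.End.eigenspace T (l : ℂ)) ∧
        (∀ k : ℤ, W k = ⨆ l : ℤ, ⨆ _ : l ≤ k, Module.End.eigenspace T (l : ℂ)) ∧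
        (∀ (p : ℤ) (v : V), v ∈ F p → T v ∈ F p) := by
  obtain ⟨hint, hF, hW⟩ := hJ
  obtain ⟨T, hT⟩ : ∃ T : Module.End ℂ V, ∀ (i : ℤ × ℤ) (v : V), v ∈ J i →
      T v = ((i.1 + i.2 : ℤ) : ℂ) • v := by
    let e := LinearEquiv.ofBijective (DirectSum.coeLinearMap J) hint
    refine ⟨(DirectSum.toModule ℂ (ℤ × ℤ) V
      (fun i => ((i.1 + i.2 : ℤ) : ℂ) • (J i).subtype)) ∘ₗ e.symm.toLinearMap, ?_⟩
    intro i v hv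
    have : e.symm v = DirectSum.lof ℂ (ℤ × ℤ) (fun i => J i) i ⟨v, hv⟩ := by
      rw [LinearEquiv.symm_apply_eq]
      exact (DirectSum.coeLinearMap_lof J i ⟨v, hv⟩).symm
    simp only [LinearMap.comp_apply, LinearEquiv.coe_coe]
    rw [this, DirectSum.toModule_lof]
    rfl
  have hJtop := hint.submodule_iSup_eq_top
  have hJE : ∀ i, J i ≤ Module.End.eigenspace T ((i.1 + i.2 : ℤ) : ℂ) := fun i v hv =>
    Module.End.mem_eigenspace_iff.2 (hT i v hv)
  have hAE : ∀ l : ℤ, (⨆ rs : ℤ × ℤ, ⨆ _ : rs.1 + rs.2 = l, J rs)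
      = Module.End.eigenspace T (l : ℂ) := by
    apply aux_le_eq (fun l : ℤ => ⨆ rs : ℤ × ℤ, ⨆ _ : rs.1 + rs.2 = l, J rs)
      (fun l : ℤ => Module.End.eigenspace T (l : ℂ)) (aux_intEig_indep T)
    · intro l
      refine iSup₂_le fun rs h => ?_
      subst h
      exact hJE rs
    · rw [eq_top_iff, ← hJtop]
      exact iSup_le fun rs => le_iSup_of_le (rs.1 + rs.2) (le_iSup₂_of_le rs rfl le_rfl)
  refine ⟨T, ?_, ?_, ?_, ?_⟩
  · intro v
    have h0 : c.σ 0 = 0 := by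
      have := c.map_smul 0 0
      simpa using this
    have hv : v ∈ ⨆ i, J i := by rw [hJtop]; trivial
    induction hv using Submodule.iSup_induction' with
    | mem i x hx =>
      rw [hT i x hx, c.map_smul, hT (i.2, i.1) _ (hc i.1 i.2 x hx)]
      simp [add_comm]
    | zero => simp [h0]
    | add x y _ _ hx hy => rw [map_add, c.map_add, hx, hy, c.map_add, map_add]
  · apply DirectSum.isInternal_submodule_of_iSupIndep_of_iSup_eq_top (aux_intEig_indep T)
    rw [eq_top_iff, ← hJtop]
    exact iSup_le fun rs => le_iSup_of_le (rs.1 + rs.2) (hJE rs)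
  · intro k
    rw [hW]
    apply le_antisymm
    · exact iSup₂_le fun rs h => le_iSup₂_of_le (rs.1 + rs.2) h (hJE rs)
    · refine iSup₂_le fun l hl => ?_
      rw [← hAE]
      exact iSup₂_le fun rs h => le_iSup₂_of_le rs (h.trans_le hl) le_rfl
  · intro p
    have : F p ≤ (F p).comap T := by
      conv_lhs => rw [hF]
      refine iSup₂_le fun rs h v hv => ?_
      rw [Submodule.mem_comap, hT rs v hv]
      apply Submodule.smul_mem
      rw [hF]
      exact (le_iSup₂_of_le (f := fun (rs : ℤ × ℤ) (_ : p ≤ rs.1) => J rs) rs h le_rfl) hv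
    exact this

theorem aux_backward [FiniteDimensional ℂ V] (c : ConjOp V) (W F : ℤ → Submodule ℂ V)
    (hmhs : IsMHS c W F) (T : Module.End ℂ V)
    (hTc : ∀ v : V, c.σ (T v) = T (c.σ v))
    (hint : DirectSum.IsInternal (fun l : ℤ => Module.End.eigenspace T (l : ℂ)))
    (hW : ∀ k : ℤ, W k = ⨆ l : ℤ, ⨆ _ : l ≤ k, Module.End.eigenspace T (l : ℂ))
    (hTF : ∀ (p : ℤ) (v : V), v ∈ F p → T v ∈ F p) :
    ∃ J : ℤ × ℤ → Submodule ℂ V, IsBigrading W F J ∧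
        ∀ (p q : ℤ) (v : V), v ∈ J (p, q) → c.σ v ∈ J (q, p) := by
  obtain ⟨-, hFanti, -, -, ⟨a, ha⟩, ⟨b, hb⟩, -, hopp⟩ := hmhs
  have htop := hint.submodule_iSup_eq_top
  have hind := aux_intEig_indep T
  have hWE : ∀ k l : ℤ, k < l → ∀ x, x ∈ Module.End.eigenspace T (l : ℂ) → x ∈ W k → x = 0 := by
    intro k l hkl x hx hxW
    refine Submodule.disjoint_def.1 (hind l) x hx ?_
    rw [hW] at hxW
    exact (iSup₂_le fun m hm => le_iSup₂_of_le
      (f := fun (j : ℤ) (_ : j ≠ l) => Module.End.eigenspace T (j : ℂ)) m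
        (by omega) le_rfl) hxW
  have hEW : ∀ k l : ℤ, l ≤ k → Module.End.eigenspace T (l : ℂ) ≤ W k := by
    intro k l h
    rw [hW]
    exact le_iSup₂_of_le l h le_rfl
  have hWT : ∀ k : ℤ, ∀ v ∈ W k, T v ∈ W k := by
    intro k
    have : W k ≤ (W k).comap T := by
      conv_lhs => rw [hW]
      refine iSup₂_le fun l h v hv => ?_
      rw [Submodule.mem_comap, Module.End.mem_eigenspace_iff.1 hv]
      exact Submodule.smul_mem _ _ (hEW k l h hv)
    exact this
  have hGT : ∀ p v, v ∈ conjSub c (F p) → T v ∈ conjSub c (F p) := by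
    intro p v hv
    change c.σ (T v) ∈ F p
    rw [hTc]
    exact hTF p _ hv
  have hEc : ∀ (l : ℤ) v, v ∈ Module.End.eigenspace T (l : ℂ) →
      c.σ v ∈ Module.End.eigenspace T (l : ℂ) := by
    intro l v hv
    rw [Module.End.mem_eigenspace_iff] at hv ⊢
    rw [← hTc, hv, c.map_smul]
    simp
  have hsplit : ∀ (P : Submodule ℂ V), (∀ v ∈ P, T v ∈ P) → ∀ l : ℤ,
      P ⊓ W l ≤ (P ⊓ Module.End.eigenspace T (l : ℂ)) ⊔ W (l - 1) := by
    intro P hP l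
    refine (aux_inv T htop (P ⊓ W l) (fun v hv => ⟨hP v hv.1, hWT l v hv.2⟩)).trans ?_
    refine iSup_le fun m => ?_
    rcases lt_trichotomy m l with h | h | h
    · exact le_sup_of_le_right (inf_le_right.trans (hEW _ _ (by omega)))
    · subst h
      exact le_sup_of_le_left (inf_le_inf_right _ inf_le_left)
    · rintro x ⟨⟨_, hxW⟩, hxE⟩
      rw [hWE l m h x hxE hxW]
      exact Submodule.zero_mem _
  -- opposedness on the eigenspaces
  have hdisj : ∀ l p q : ℤ, p + q = l + 1 → ∀ x, x ∈ Module.End.eigenspace T (l : ℂ) →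
      x ∈ F p → x ∈ conjSub c (F q) → x = 0 := by
    intro l p q hpq x hxE hxF hxG
    obtain rfl : q = l + 1 - p := by omega
    have h1 := (hopp l p).1
    have hxW : x ∈ W l := hEW l l le_rfl hxE
    have : ((W (l - 1)).comap (W l).subtype).mkQ ⟨x, hxW⟩ ∈
        inducedFil W l (F p) ⊓ inducedFil W l (conjSub c (F (l + 1 - p))) :=
      ⟨Submodule.mem_map_of_mem (by exact hxF), Submodule.mem_map_of_mem (by exact hxG)⟩
    rw [h1, Submodule.mem_bot, Submodule.mkQ_apply, Submodule.Quotient.mk_eq_zero] at this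
    exact hWE (l - 1) l (by omega) x hxE this
  have hsum : ∀ l p q : ℤ, p + q = l + 1 → ∀ x, x ∈ Module.End.eigenspace T (l : ℂ) →
      ∃ y ∈ F p ⊓ Module.End.eigenspace T (l : ℂ),
      ∃ z ∈ conjSub c (F q) ⊓ Module.End.eigenspace T (l : ℂ), y + z = x := by
    intro l p q hpq x hxE
    obtain rfl : q = l + 1 - p := by omega
    have h1 := (hopp l p).2
    have hxW : x ∈ W l := hEW l l le_rfl hxE
    have hm : ((W (l - 1)).comap (W l).subtype).mkQ ⟨x, hxW⟩ ∈
        inducedFil W l (F p) ⊔ inducedFil W l (conjSub c (F (l + 1 - p))) := by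
      rw [h1]; trivial
    obtain ⟨_, ⟨y, hy, rfl⟩, _, ⟨z, hz, rfl⟩, hyz⟩ := Submodule.mem_sup.1 hm
    rw [← map_add, Submodule.mkQ_apply, Submodule.mkQ_apply, Submodule.Quotient.eq] at hyz
    have hw : (y : V) + z - x ∈ W (l - 1) := hyz
    obtain ⟨y1, hy1, w1, hw1, e1⟩ :=
      Submodule.mem_sup.1 (hsplit (F p) (hTF p) l (show (y : V) ∈ _ from ⟨hy, y.2⟩))
    obtain ⟨z1, hz1, w2, hw2, e2⟩ :=
      Submodule.mem_sup.1 (hsplit _ (hGT (l + 1 - p)) l (show (z : V) ∈ _ from ⟨hz, z.2⟩))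
    refine ⟨y1, hy1, z1, hz1, ?_⟩
    have hE : y1 + z1 - x ∈ Module.End.eigenspace T (l : ℂ) :=
      Submodule.sub_mem _ (Submodule.add_mem _ hy1.2 hz1.2) hxE
    have hW' : y1 + z1 - x ∈ W (l - 1) := by
      have : y1 + z1 - x = ((y : V) + z - x) - w1 - w2 := by
        rw [← e1, ← e2]; abel
      rw [this]
      exact Submodule.sub_mem _ (Submodule.sub_mem _ hw hw1) hw2
    exact sub_eq_zero.1 (hWE (l - 1) l (by omega) _ hE hW')
  have hGanti : ∀ {p q : ℤ}, p ≤ q → conjSub c (F q) ≤ conjSub c (F p) :=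
    fun h v hv => hFanti h hv
  let J : ℤ × ℤ → Submodule ℂ V := fun rs =>
    Module.End.eigenspace T ((rs.1 + rs.2 : ℤ) : ℂ) ⊓ F rs.1 ⊓ conjSub c (F rs.2)
  -- Hodge decomposition of the pieces
  have hdec : ∀ l : ℤ, ∀ n : ℕ, ∀ p : ℤ, a ≤ p + n →
      F p ⊓ Module.End.eigenspace T (l : ℂ) ≤
        ⨆ rs : ℤ × ℤ, ⨆ _ : p ≤ rs.1 ∧ rs.1 + rs.2 = l, J rs := by
    intro l n
    induction n with
    | zero =>
      intro p hp
      rw [ha p (by simpa using hp)]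
      simp
    | succ n ih =>
      intro p hp
      rintro x ⟨hxF, hxE⟩
      obtain ⟨y, hy, z, hz, rfl⟩ := hsum l (p + 1) (l - p) (by omega) x hxE
      apply Submodule.add_mem
      · have h1 := ih (p + 1) (by push_cast at hp; omega) hy
        exact (iSup₂_le fun rs h => le_iSup₂_of_le
          (f := fun (rs : ℤ × ℤ) (_ : p ≤ rs.1 ∧ rs.1 + rs.2 = l) => J rs) rs
            ⟨by omega, h.2⟩ le_rfl) h1
      · have hzF : z ∈ F p := by
          have := (F p).sub_mem hxF (hFanti (by omega : p ≤ p + 1) hy.1)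
          simpa using this
        refine (le_iSup₂_of_le
          (f := fun (rs : ℤ × ℤ) (_ : p ≤ rs.1 ∧ rs.1 + rs.2 = l) => J rs) (p, l - p)
            ⟨le_rfl, by simp⟩ le_rfl) ?_
        refine ⟨⟨?_, hzF⟩, hz.1⟩
        have : p + (l - p) = l := by omega
        change z ∈ Module.End.eigenspace T ((p + (l - p) : ℤ) : ℂ)
        rw [this]
        exact hz.2
  have hdec' : ∀ l p : ℤ, F p ⊓ Module.End.eigenspace T (l : ℂ) ≤
        ⨆ rs : ℤ × ℤ, ⨆ _ : p ≤ rs.1 ∧ rs.1 + rs.2 = l, J rs :=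
    fun l p => hdec l (a - p).toNat p (by omega)
  have hEJ : ∀ l : ℤ, Module.End.eigenspace T (l : ℂ) ≤
      ⨆ rs : ℤ × ℤ, ⨆ _ : rs.1 + rs.2 = l, J rs := by
    intro l x hx
    have := hdec' l b (show x ∈ _ from ⟨by rw [hb b le_rfl]; trivial, hx⟩)
    exact (iSup₂_le fun rs h => le_iSup₂_of_le
          (f := fun (rs : ℤ × ℤ) (_ : rs.1 + rs.2 = l) => J rs) rs h.2 le_rfl) this
  have hJE : ∀ rs, J rs ≤ Module.End.eigenspace T ((rs.1 + rs.2 : ℤ) : ℂ) :=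
    fun rs x hx => hx.1.1
  refine ⟨J, ⟨?_, ?_, ?_⟩, ?_⟩
  · apply DirectSum.isInternal_submodule_of_iSupIndep_of_iSup_eq_top
    · rintro ⟨p, q⟩
      rw [Submodule.disjoint_def]
      intro x hx hx'
      have hle : (⨆ j, ⨆ _ : j ≠ (p, q), J j) ≤
          ((F (p + 1) ⊓ Module.End.eigenspace T ((p + q : ℤ) : ℂ)) ⊔
            (conjSub c (F (q + 1)) ⊓ Module.End.eigenspace T ((p + q : ℤ) : ℂ))) ⊔
          ⨆ m : ℤ, ⨆ _ : m ≠ p + q, Module.End.eigenspace T (m : ℂ) := by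
        refine iSup₂_le ?_
        rintro ⟨r, s⟩ hne
        by_cases hl : r + s = p + q
        · apply le_sup_of_le_left
          have hE : J (r, s) ≤ Module.End.eigenspace T ((p + q : ℤ) : ℂ) := by
            rw [← hl]; exact hJE (r, s)
          rcases lt_trichotomy r p with h | h | h
          · apply le_sup_of_le_right
            exact fun y hy => ⟨hGanti (by omega : q + 1 ≤ s) hy.2, hE hy⟩
          · exact absurd (Prod.ext h (by simp only; omega)) hne
          · apply le_sup_of_le_left
            exact fun y hy => ⟨hFanti (by omega : p + 1 ≤ r) hy.1.2, hE hy⟩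
        · apply le_sup_of_le_right
          exact le_iSup₂_of_le (r + s) hl (hJE (r, s))
      obtain ⟨u, hu, z, hz, e⟩ := Submodule.mem_sup.1 (hle hx')
      obtain ⟨y1, hy1, y2, hy2, rfl⟩ := Submodule.mem_sup.1 hu
      have hxE := hx.1.1
      have hz0 : z = 0 := by
        refine Submodule.disjoint_def.1 (hind (p + q)) z ?_ hz
        have : z = x - (y1 + y2) := by rw [← e]; abel
        rw [this]
        exact Submodule.sub_mem _ hxE (Submodule.add_mem _ hy1.2 hy2.2)
      subst hz0
      rw [add_zero] at e
      have hy20 : y2 = 0 := by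
        refine hdisj (p + q) p (q + 1) (by omega) y2 hy2.2 ?_ hy2.1
        have : y2 = x - y1 := by rw [← e]; abel
        rw [this]
        exact Submodule.sub_mem _ hx.1.2 (hFanti (by omega : p ≤ p + 1) hy1.1)
      subst hy20
      rw [add_zero] at e
      subst e
      exact hdisj (p + q) (p + 1) q (by omega) y1 hxE hy1.1 hx.2
    · rw [eq_top_iff, ← htop]
      exact iSup_le fun l => (hEJ l).trans (iSup₂_le fun rs _ => le_iSup J rs)
  · intro p
    apply le_antisymm
    · refine (aux_inv T htop (F p) (hTF p)).trans (iSup_le fun l => (hdec' l p).trans ?_)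
      exact iSup₂_le fun rs h => le_iSup₂_of_le rs h.1 le_rfl
    · exact iSup₂_le fun rs h x hx => hFanti h hx.1.2
  · intro k
    apply le_antisymm
    · rw [hW]
      refine iSup₂_le fun l hl => (hEJ l).trans ?_
      exact iSup₂_le fun rs h => le_iSup₂_of_le rs (h.trans_le hl) le_rfl
    · exact iSup₂_le fun rs h => (hJE rs).trans (hEW k _ h)
  · rintro p q v ⟨⟨hE, hF⟩, hG⟩
    refine ⟨⟨?_, hG⟩, ?_⟩
    · change c.σ v ∈ Module.End.eigenspace T ((q + p : ℤ) : ℂ)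
      rw [add_comm q p]
      exact hEc _ v hE
    · change c.σ (c.σ v) ∈ F p
      rw [c.invol]
      exact hF


/-- A real mixed Hodge structure admits a bigrading `{J^{p,q}}`
with `conj(J^{p,q}) = J^{q,p}` if and only if there is a real semisimple
endomorphism `T` with integer eigenvalues whose eigenspaces split the weight
filtration `W` and which preserves the Hodge filtration `F`. -/
theorem real_bigrading_iff_real_splitting_operator
    [FiniteDimensional ℂ V] (c : ConjOp V) (W F : ℤ → Submodule ℂ V)
    (hmhs : IsMHS c W F) :
    (∃ J : ℤ × ℤ → Submodule ℂ V, IsBigrading W F J ∧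
        ∀ (p q : ℤ) (v : V), v ∈ J (p, q) → c.σ v ∈ J (q, p)) ↔
      (∃ T : Module.End ℂ V,
        -- `T` is defined over `ℝ`
        (∀ v : V, c.σ (T v) = T (c.σ v)) ∧
        -- `T` is semisimple with integer eigenvalues
        DirectSum.IsInternal (fun l : ℤ => Module.End.eigenspace T (l : ℂ)) ∧
        -- the eigenspaces split the weight filtration
        (∀ k : ℤ, W k = ⨆ l : ℤ, ⨆ _ : l ≤ k, Module.End.eigenspace T (l : ℂ)) ∧
        -- `T` preserves the Hodge filtration
        (∀ (p : ℤ) (v : V), v ∈ F p → T v ∈ F p)) := by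
  constructor
  · rintro ⟨J, hJ, hc⟩
    exact aux_forward c W F J hJ hc
  · rintro ⟨T, h1, h2, h3, h4⟩
    exact aux_backward c W F hmhs T h1 h2 h3 h4
end

section
/- Every real mixed Hodge structure (V, W, F) admits a unique bigrading {I^{p,q}} satisfying the congruence condition I^{p,q} ≡ conjugate(I^{q,p}) mod ⊕_{r<p, s<q} I^{r,s}. Moreover this bigrading is given explicitly by I^{p,q} = (F^p ∩ (W_{p+q})_ℂ) ∩ (F̄^q ∩ (W_{p+q})_ℂ + Σ_{j≥0} F̄^{q-1-j} ∩ (W_{p+q-2-j})_ℂ). -/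
variable {V : Type*} [AddCommGroup V] [Module ℂ V]

/-- Deligne's congruence condition on a bigrading:
`conj(I^{p,q}) ≡ I^{q,p} mod ⊕_{r<q, s<p} I^{r,s}` (equivalently
`I^{p,q} ≡ conj(I^{q,p}) mod ⊕_{r<p, s<q} I^{r,s}`). -/
def DeligneCongr (c : ConjOp V) (J : ℤ × ℤ → Submodule ℂ V) : Prop :=
  ∀ (p q : ℤ) (v : V), v ∈ J (p, q) →
    c.σ v ∈ J (q, p) ⊔ ⨆ rs : ℤ × ℤ, ⨆ _ : rs.1 < q ∧ rs.2 < p, J rs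

/-- Deligne's explicit formula:
`I^{p,q} = (F^p ∩ W_{p+q}) ∩ (F̄^q ∩ W_{p+q} + Σ_{j≥0} F̄^{q-1-j} ∩ W_{p+q-2-j})`. -/
def deligneI (c : ConjOp V) (W F : ℤ → Submodule ℂ V) (p q : ℤ) :
    Submodule ℂ V :=
  (F p ⊓ W (p + q)) ⊓
    ((conjSub c (F q) ⊓ W (p + q)) ⊔
      ⨆ j : ℕ, conjSub c (F (q - 1 - (j : ℤ))) ⊓ W (p + q - 2 - (j : ℤ)))

namespace DeligneAux

/-- The second factor of Deligne's formula. -/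
def U (c : ConjOp V) (W F : ℤ → Submodule ℂ V) (p q : ℤ) : Submodule ℂ V :=
  (conjSub c (F q) ⊓ W (p + q)) ⊔
      ⨆ j : ℕ, conjSub c (F (q - 1 - (j : ℤ))) ⊓ W (p + q - 2 - (j : ℤ))

theorem deligneI_eq (c : ConjOp V) (W F : ℤ → Submodule ℂ V) (p q : ℤ) :
    deligneI c W F p q = (F p ⊓ W (p + q)) ⊓ U c W F p q := rfl

theorem mem_conjSub {c : ConjOp V} {A : Submodule ℂ V} {v : V} :
    v ∈ conjSub c A ↔ c.σ v ∈ A := Iff.rfl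

theorem mem_of_le {A B : Submodule ℂ V} {x : V} (hx : x ∈ A) (h : A ≤ B) : x ∈ B := h hx

theorem conj_anti {c : ConjOp V} {F : ℤ → Submodule ℂ V} (hF : Antitone F) {p q : ℤ}
    (h : p ≤ q) : conjSub c (F q) ≤ conjSub c (F p) := fun _ hx => hF h hx

theorem mem_inducedFil {W : ℤ → Submodule ℂ V} {l : ℤ} {A : Submodule ℂ V} {v : V}
    (hv : v ∈ W l) :
    (((W (l - 1)).comap (W l).subtype).mkQ ⟨v, hv⟩ ∈ inducedFil W l A) ↔
      ∃ u, u ∈ A ∧ u ∈ W l ∧ v - u ∈ W (l - 1) := by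
  unfold inducedFil
  rw [Submodule.mem_map]
  constructor
  · rintro ⟨⟨u, hu⟩, huA, he⟩
    refine ⟨u, huA, hu, ?_⟩
    rw [Submodule.mkQ_apply, Submodule.mkQ_apply, eq_comm, Submodule.Quotient.eq] at he
    exact he
  · rintro ⟨u, huA, hu, he⟩
    refine ⟨⟨u, hu⟩, huA, ?_⟩
    rw [Submodule.mkQ_apply, Submodule.mkQ_apply, eq_comm, Submodule.Quotient.eq]
    exact he

theorem propA {c : ConjOp V} {W F : ℤ → Submodule ℂ V} (h : IsMHS c W F) {l p q : ℤ}
    (hpq : l + 1 ≤ p + q) {x y : V} (hxF : x ∈ F p) (hx : x ∈ W l)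
    (hyG : y ∈ conjSub c (F q)) (hxy : x - y ∈ W (l - 1)) : x ∈ W (l - 1) := by
  obtain ⟨hW, hF, -, -, -, -, -, hop⟩ := h
  have hy : y ∈ W l := by
    have := (W l).sub_mem hx (hW (by omega : l - 1 ≤ l) hxy)
    simpa using this
  have h1 := (hop l p).1
  have hm : ((W (l - 1)).comap (W l).subtype).mkQ ⟨x, hx⟩ ∈
      inducedFil W l (F p) ⊓ inducedFil W l (conjSub c (F (l + 1 - p))) := by
    refine ⟨(mem_inducedFil hx).2 ⟨x, hxF, hx, by simp⟩,
      (mem_inducedFil hx).2 ⟨y, conj_anti hF (by omega) hyG, hy, hxy⟩⟩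
  rw [h1, Submodule.mem_bot, Submodule.mkQ_apply, Submodule.Quotient.mk_eq_zero] at hm
  exact hm

theorem propB {c : ConjOp V} {W F : ℤ → Submodule ℂ V} (h : IsMHS c W F) {l p q : ℤ}
    (hpq : p + q ≤ l + 1) {w : V} (hw : w ∈ W l) :
    ∃ f g r, f ∈ F p ∧ f ∈ W l ∧ g ∈ conjSub c (F q) ∧ g ∈ W l ∧ r ∈ W (l - 1) ∧
      w = f + g + r := by
  obtain ⟨hW, hF, -, -, -, -, -, hop⟩ := h
  have h1 := (hop l p).2
  have hm : ((W (l - 1)).comap (W l).subtype).mkQ ⟨w, hw⟩ ∈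
      inducedFil W l (F p) ⊔ inducedFil W l (conjSub c (F (l + 1 - p))) := by
    rw [h1]; trivial
  unfold inducedFil at hm
  rw [← Submodule.map_sup, Submodule.mem_map] at hm
  obtain ⟨⟨y, hy⟩, hys, he⟩ := hm
  rw [Submodule.mem_sup] at hys
  obtain ⟨⟨f, hf⟩, hfF, ⟨g, hg⟩, hgG, hfg⟩ := hys
  rw [Submodule.mkQ_apply, Submodule.mkQ_apply, eq_comm, Submodule.Quotient.eq] at he
  have he' : w - y ∈ W (l - 1) := he
  have hfg' : f + g = y := congrArg Subtype.val hfg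
  refine ⟨f, g, w - y, hfF, hf, conj_anti hF (by omega) hgG, hg, he', ?_⟩
  rw [hfg']; abel

/-- Induction upwards along the weight filtration. -/
theorem intInd {P : ℤ → Prop} (a : ℤ) (h0 : ∀ k ≤ a, P k) (hs : ∀ k, P (k - 1) → P k) (k : ℤ) :
    P k := by
  have : ∀ n : ℕ, P (a + n) := by
    intro n
    induction n with
    | zero => simpa using h0 a le_rfl
    | succ n ih =>
      apply hs
      have e : a + ((n + 1 : ℕ) : ℤ) - 1 = a + n := by push_cast; ring
      rw [e]; exact ih
  rcases le_total k a with hk | hk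
  · exact h0 k hk
  · have := this (k - a).toNat
    have e : a + ((k - a).toNat : ℤ) = k := by omega
    rwa [e] at this

theorem U_le {c : ConjOp V} {W F : ℤ → Submodule ℂ V} (h : IsMHS c W F) {p q m : ℤ}
    (hmq : m ≤ p + q - 1) :
    U c W F p q ≤ conjSub c (F (m + 1 - p)) ⊔ W (m - 1) := by
  obtain ⟨hW, hF, -⟩ := h
  refine sup_le (le_trans inf_le_left (le_trans (conj_anti hF (by omega)) le_sup_left))
    (iSup_le fun j => ?_)
  by_cases hj : m + 1 - p ≤ q - 1 - j
  · exact le_trans inf_le_left (le_trans (conj_anti hF hj) le_sup_left)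
  · exact le_trans inf_le_right (le_trans (hW (by omega)) le_sup_right)

theorem W_le_tail {c : ConjOp V} {W F : ℤ → Submodule ℂ V} (h : IsMHS c W F) (p q : ℤ) :
    W (p + q - 2) ≤ (F p ⊓ W (p + q - 2)) ⊔
      ⨆ j : ℕ, conjSub c (F (q - 1 - (j : ℤ))) ⊓ W (p + q - 2 - (j : ℤ)) := by
  obtain ⟨a, ha⟩ := h.2.2.1
  have hW := h.1
  refine intInd (P := fun q => W (p + q - 2) ≤ (F p ⊓ W (p + q - 2)) ⊔
      ⨆ j : ℕ, conjSub c (F (q - 1 - (j : ℤ))) ⊓ W (p + q - 2 - (j : ℤ))) (a + 2 - p) ?_ ?_ q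
  · intro k hk
    rw [ha (p + k - 2) (by omega)]
    exact bot_le
  · intro k ih w hw
    obtain ⟨f, g, r, hf, hfW, hg, hgW, hr, rfl⟩ := propB h (p := p) (q := k - 1) (by omega) hw
    refine Submodule.add_mem _ (Submodule.add_mem _ ?_ ?_) ?_
    · exact Submodule.mem_sup_left ⟨hf, hfW⟩
    · refine Submodule.mem_sup_right (Submodule.mem_iSup_of_mem 0 ?_)
      simpa using And.intro hg hgW
    · have e : p + k - 2 - 1 = p + (k - 1) - 2 := by ring
      rw [e] at hr
      refine mem_of_le (ih hr) (sup_le ?_ (iSup_le fun j => ?_))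
      · exact le_trans (inf_le_inf le_rfl (hW (by omega))) le_sup_left
      · refine le_trans ?_ (le_trans (le_iSup _ (j + 1)) le_sup_right)
        have e1 : k - 1 - 1 - (j : ℤ) = k - 1 - ((j + 1 : ℕ) : ℤ) := by push_cast; ring
        have e2 : p + (k - 1) - 2 - (j : ℤ) = p + k - 2 - ((j + 1 : ℕ) : ℤ) := by push_cast; ring
        rw [e1, e2]

theorem lift {c : ConjOp V} {W F : ℤ → Submodule ℂ V} (h : IsMHS c W F) {p q : ℤ} {x y : V}
    (hx : x ∈ F p) (hxW : x ∈ W (p + q)) (hy : y ∈ conjSub c (F q)) (hyW : y ∈ W (p + q))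
    (hxy : x - y ∈ W (p + q - 1)) :
    ∃ i ∈ deligneI c W F p q, x - i ∈ W (p + q - 1) := by
  have hW := h.1
  obtain ⟨f, g, r, hf, hfW, hg, hgW, hr, he⟩ := propB h (p := p) (q := q) (by omega) hxy
  have e : p + q - 1 - 1 = p + q - 2 := by ring
  rw [e] at hr
  obtain ⟨f', ⟨hf', hfW'⟩, r', hr', hs⟩ := Submodule.mem_sup.1 (W_le_tail h p q hr)
  have hfW1 : f' ∈ W (p + q - 1) := hW (by omega) hfW'
  refine ⟨x - f - f', ?_, ?_⟩
  · rw [deligneI_eq]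
    refine ⟨⟨Submodule.sub_mem _ (Submodule.sub_mem _ hx hf) hf', Submodule.sub_mem _
      (Submodule.sub_mem _ hxW (hW (by omega) hfW)) (hW (by omega) hfW1)⟩, ?_⟩
    have : x - f - f' = (y + g) + r' := by
      have : x = y + (f + g + r) := by rw [← he]; abel
      rw [this, ← hs]; abel
    rw [this]
    exact Submodule.add_mem _ (Submodule.mem_sup_left ⟨Submodule.add_mem _ hy hg,
      Submodule.add_mem _ hyW (hW (by omega) hgW)⟩) (Submodule.mem_sup_right hr')
  · have : x - (x - f - f') = f + f' := by abel
    rw [this]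
    exact Submodule.add_mem _ hfW hfW1

theorem inj {c : ConjOp V} {W F : ℤ → Submodule ℂ V} (h : IsMHS c W F) {p q : ℤ} {x : V}
    (hx : x ∈ deligneI c W F p q) (hxW : x ∈ W (p + q - 1)) : x = 0 := by
  obtain ⟨a, ha⟩ := h.2.2.1
  have hW := h.1
  have key : ∀ m, m ≤ p + q - 1 → x ∈ W m → x = 0 := by
    refine intInd a ?_ ?_
    · intro k hk _ hxk
      rw [ha k hk] at hxk
      simpa using hxk
    · intro k ih hk hxk
      refine ih (by omega) ?_
      obtain ⟨g, hg, w, hw, he⟩ := Submodule.mem_sup.1 (U_le h hk hx.2)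
      refine propA h (p := p) (q := k + 1 - p) (by omega) hx.1.1 hxk hg ?_
      rw [← he]; simpa using hw
  exact key _ le_rfl hxW

/-- `F^p ∩ W_l` is spanned by the `I^{r,s}` with `r ≥ p`, `r + s ≤ l`. -/
theorem FW_le {c : ConjOp V} {W F : ℤ → Submodule ℂ V} (h : IsMHS c W F) (l p : ℤ) :
    F p ⊓ W l ≤ ⨆ rs : ℤ × ℤ, ⨆ _ : p ≤ rs.1 ∧ rs.1 + rs.2 ≤ l, deligneI c W F rs.1 rs.2 := by
  obtain ⟨a, ha⟩ := h.2.2.1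
  obtain ⟨a', ha'⟩ := h.2.2.2.2.1
  have hW := h.1
  have hF := h.2.1
  revert p
  refine intInd (P := fun l => ∀ p, F p ⊓ W l ≤ ⨆ rs : ℤ × ℤ,
    ⨆ _ : p ≤ rs.1 ∧ rs.1 + rs.2 ≤ l, deligneI c W F rs.1 rs.2) a ?_ ?_ l
  · intro k hk p
    rw [ha k hk]; simp
  · intro l ih p
    have key : ∀ n, F (-n) ⊓ W l ≤ ⨆ rs : ℤ × ℤ,
        ⨆ _ : -n ≤ rs.1 ∧ rs.1 + rs.2 ≤ l, deligneI c W F rs.1 rs.2 := by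
      refine intInd (-a') ?_ ?_
      · intro k hk
        rw [ha' (-k) (by omega)]; simp
      · intro n ih2 x hx
        obtain ⟨p, rfl⟩ : ∃ p, n = -p := ⟨-n, by ring⟩
        rw [neg_neg] at *
        have e : -(-p - 1) = p + 1 := by ring
        rw [e] at ih2
        obtain ⟨f, g, w, hf, hfW, hg, hgW, hw, he⟩ :=
          propB h (p := p + 1) (q := l - p) (by omega) hx.2
        have el : p + (l - p) = l := by ring
        have hxf : x - f ∈ F p := Submodule.sub_mem _ hx.1 (hF (by omega) hf)
        obtain ⟨i, hi, hi'⟩ := lift h (p := p) (q := l - p) (x := x - f) (y := g)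
          hxf (by rw [el]; exact Submodule.sub_mem _ hx.2 hfW) hg (by rwa [el])
          (by rw [el, he]; convert hw using 1; abel)
        rw [el] at hi'
        have hz : x - f - i ∈ F p ⊓ W (l - 1) := ⟨Submodule.sub_mem _ hxf hi.1.1, hi'⟩
        have : x = f + i + (x - f - i) := by abel
        rw [this]
        refine Submodule.add_mem _ (Submodule.add_mem _ ?_ ?_) ?_
        · refine mem_of_le (ih2 ⟨hf, hfW⟩) (iSup_le fun rs => iSup_le fun hrs => ?_)
          exact le_iSup₂_of_le rs ⟨by omega, hrs.2⟩ le_rfl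
        · exact Submodule.mem_iSup_of_mem (p, l - p)
            (Submodule.mem_iSup_of_mem ⟨le_rfl, by simp⟩ hi)
        · refine mem_of_le (ih p hz) (iSup_le fun rs => iSup_le fun hrs => ?_)
          exact le_iSup₂_of_le rs ⟨hrs.1, by omega⟩ le_rfl
    have := key (-p)
    rwa [neg_neg] at this

theorem indep {c : ConjOp V} {W F : ℤ → Submodule ℂ V} (h : IsMHS c W F) :
    iSupIndep (fun rs : ℤ × ℤ => deligneI c W F rs.1 rs.2) := by
  classical
  have hW := h.1
  have hF := h.2.1
  apply iSupIndep_of_dfinsupp_lsum_injective (R := ℂ)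
  rw [injective_iff_map_eq_zero]
  intro x hx
  by_contra hne
  have hsupp : x.support.Nonempty := by
    rw [Finset.nonempty_iff_ne_empty]
    simpa using hne
  obtain ⟨⟨p, q⟩, hi, hmax⟩ := x.support.exists_max_image
    (fun rs : ℤ × ℤ => toLex (rs.1 + rs.2, -rs.1)) hsupp
  have hmem := (x (p, q)).2
  have hsum : (∑ i ∈ x.support, ((x i : V))) = 0 := by
    rw [DFinsupp.lsum_apply_apply, DFinsupp.sumAddHom_apply] at hx
    exact hx
  rw [← Finset.add_sum_erase _ _ hi] at hsum
  have hrest : ∑ i ∈ x.support.erase (p, q), (x i : V) ∈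
      (F (p + 1) ⊓ W (p + q)) ⊔ W (p + q - 1) := by
    refine Submodule.sum_mem _ fun i hi' => ?_
    rw [Finset.mem_erase] at hi'
    have hm := hmax i hi'.2
    have hI := (x i).2
    obtain ⟨r, s⟩ := i
    rw [Prod.Lex.toLex_le_toLex] at hm
    simp only at hm
    have hne' : ¬ (r = p ∧ s = q) := fun hh => hi'.1 (by rw [hh.1, hh.2])
    rcases lt_or_ge (r + s) (p + q) with hlt | hge
    · exact Submodule.mem_sup_right (hW (by omega) hI.1.2)
    · have : r + s = p + q := by omega
      exact Submodule.mem_sup_left ⟨hF (by omega) hI.1.1, hW this.le hI.1.2⟩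
  have hx0 : (x (p, q) : V) ∈ (F (p + 1) ⊓ W (p + q)) ⊔ W (p + q - 1) := by
    rw [eq_neg_of_add_eq_zero_left hsum]
    exact Submodule.neg_mem _ hrest
  obtain ⟨f, hf, w, hw, he⟩ := Submodule.mem_sup.1 hx0
  obtain ⟨g, hg, w', hw', he'⟩ := Submodule.mem_sup.1 (U_le h (le_refl (p + q - 1)) hmem.2)
  have e1 : p + q - 1 + 1 - p = q := by ring
  rw [e1] at hg
  have hw1 : w' ∈ W (p + q - 1) := hW (by omega) hw'
  have hfW : f ∈ W (p + q - 1) := by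
    refine propA h (p := p + 1) (q := q) (y := g) (by omega) hf.1 hf.2 hg ?_
    have : f - g = w' - w := by
      rw [sub_eq_sub_iff_add_eq_add, he, ← he']; abel
    rw [this]
    exact Submodule.sub_mem _ hw1 hw
  have hxW : (x (p, q) : V) ∈ W (p + q - 1) := by
    rw [← he]; exact Submodule.add_mem _ hfW hw
  have := inj h hmem hxW
  rw [DFinsupp.mem_support_iff] at hi
  exact hi (Subtype.ext this)

theorem bigrading {c : ConjOp V} {W F : ℤ → Submodule ℂ V} (h : IsMHS c W F) :
    IsBigrading W F (fun rs : ℤ × ℤ => deligneI c W F rs.1 rs.2) := by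
  obtain ⟨b, hb⟩ := h.2.2.2.1
  obtain ⟨b', hb'⟩ := h.2.2.2.2.2.1
  have hW := h.1
  have hF := h.2.1
  have e1 := hb b le_rfl
  have e2 := hb' b' le_rfl
  refine ⟨?_, fun p => le_antisymm ?_ ?_, fun k => le_antisymm ?_ ?_⟩
  · rw [DirectSum.isInternal_submodule_iff_iSupIndep_and_iSup_eq_top]
    refine ⟨indep h, ?_⟩
    have := FW_le h b b'
    rw [e1, e2, inf_top_eq, top_le_iff] at this
    rw [eq_top_iff, ← this]
    exact iSup_le fun rs => iSup_le fun hrs => le_iSup_of_le rs le_rfl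
  · have := FW_le h b p
    rw [e1, inf_top_eq] at this
    exact this.trans (iSup_le fun rs => iSup_le fun hrs => le_iSup₂_of_le rs hrs.1 le_rfl)
  · exact iSup_le fun rs => iSup_le fun hrs => fun x hx => hF hrs hx.1.1
  · have := FW_le h k b'
    rw [e2, top_inf_eq] at this
    exact this.trans (iSup_le fun rs => iSup_le fun hrs => le_iSup₂_of_le rs hrs.2 le_rfl)
  · exact iSup_le fun rs => iSup_le fun hrs => fun x hx => hW hrs hx.1.2

theorem I_le_U {c : ConjOp V} {W F : ℤ → Submodule ℂ V} (h : IsMHS c W F) {p q r s : ℤ}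
    (hr : r < p) (hs : s < q) : deligneI c W F r s ≤ U c W F p q := by
  have hW := h.1
  have hF := h.2.1
  refine le_trans (inf_le_right : _ ≤ U c W F r s) (sup_le ?_ (iSup_le fun k => ?_))
  · refine le_sup_of_le_right (le_iSup_of_le (q - 1 - s).toNat
      (inf_le_inf (conj_anti hF ?_) (hW ?_))) <;> omega
  · refine le_sup_of_le_right (le_iSup_of_le ((q - 1 - s).toNat + k + 1)
      (inf_le_inf (conj_anti hF ?_) (hW ?_))) <;> push_cast <;> omega

theorem congr {c : ConjOp V} {W F : ℤ → Submodule ℂ V} (h : IsMHS c W F) :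
    DeligneCongr c (fun rs : ℤ × ℤ => deligneI c W F rs.1 rs.2) := by
  have hW := h.1
  have hF := h.2.1
  have hc := h.2.2.2.2.2.2.1
  intro p q v hv
  have hT : U c W F p q ≤ conjSub c ((F q ⊓ W (q + p)) ⊔
      ⨆ rs : ℤ × ℤ, ⨆ _ : rs.1 < q ∧ rs.2 < p, deligneI c W F rs.1 rs.2) := by
    refine sup_le ?_ (iSup_le fun j => ?_)
    · intro x hx
      exact Submodule.mem_sup_left ⟨hx.1, add_comm p q ▸ hc _ _ hx.2⟩
    · intro x hx
      have hm : c.σ x ∈ F (q - 1 - j) ⊓ W (p + q - 2 - j) := ⟨hx.1, hc _ _ hx.2⟩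
      rw [mem_conjSub]
      refine mem_of_le (FW_le h _ _ hm) (iSup_le fun rs => iSup_le fun hrs => ?_)
      by_cases hq : rs.1 < q
      · exact le_trans (le_iSup₂_of_le rs ⟨hq, by omega⟩ le_rfl) le_sup_right
      · exact le_sup_of_le_left (fun y hy => ⟨hF (by omega) hy.1.1, hW (by omega) hy.1.2⟩)
  obtain ⟨a, ha, b, hb, he⟩ := Submodule.mem_sup.1 (mem_conjSub.1 (hT hv.2))
  rw [← he]
  refine Submodule.add_mem _ (Submodule.mem_sup_left ⟨ha, ?_⟩) (Submodule.mem_sup_right hb)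
  have : a = c.σ v - b := by rw [← he]; abel
  rw [this]
  change _ ∈ U c W F q p
  refine Submodule.sub_mem _ (Submodule.mem_sup_left ⟨?_, ?_⟩) ?_
  · rw [SetLike.mem_coe, mem_conjSub, c.invol]; exact hv.1.1
  · exact add_comm p q ▸ hc _ _ hv.1.2
  · exact mem_of_le hb (iSup_le fun rs => iSup_le fun hrs => I_le_U h hrs.1 hrs.2)

theorem le_deligneI {c : ConjOp V} {W F : ℤ → Submodule ℂ V} (h : IsMHS c W F)
    {J : ℤ × ℤ → Submodule ℂ V} (hJ : IsBigrading W F J) (hC : DeligneCongr c J) (p q : ℤ) :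
    J (p, q) ≤ deligneI c W F p q := by
  have hW := h.1
  have hc := h.2.2.2.2.2.2.1
  have hJF : ∀ r s, J (r, s) ≤ F r := fun r s => by
    rw [hJ.2.1 r]; exact le_iSup₂_of_le (r, s) le_rfl le_rfl
  have hJW : ∀ r s, J (r, s) ≤ W (r + s) := fun r s => by
    rw [hJ.2.2 (r + s)]; exact le_iSup₂_of_le (r, s) le_rfl le_rfl
  have hT : J (q, p) ⊔ ⨆ rs : ℤ × ℤ, ⨆ _ : rs.1 < q ∧ rs.2 < p, J rs ≤
      conjSub c (U c W F p q) := by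
    refine sup_le ?_ (iSup_le fun rs => iSup_le fun hrs => ?_)
    · intro x hx
      refine Submodule.mem_sup_left ⟨?_, ?_⟩
      · rw [SetLike.mem_coe, mem_conjSub, c.invol]; exact hJF _ _ hx
      · exact add_comm q p ▸ hc _ _ (hJW _ _ hx)
    · intro x hx
      obtain ⟨r, s⟩ := rs
      simp only at hrs
      refine Submodule.mem_sup_right (Submodule.mem_iSup_of_mem (q - 1 - r).toNat ⟨?_, ?_⟩)
      · rw [SetLike.mem_coe, mem_conjSub, c.invol]
        exact h.2.1 (by omega) (hJF _ _ hx)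
      · exact hW (by omega) (hc _ _ (hJW _ _ hx))
  intro v hv
  refine ⟨⟨hJF _ _ hv, hJW _ _ hv⟩, ?_⟩
  have := hT (hC p q v hv)
  rwa [mem_conjSub, c.invol] at this

theorem eq_deligneI {c : ConjOp V} {W F : ℤ → Submodule ℂ V} (h : IsMHS c W F)
    {J : ℤ × ℤ → Submodule ℂ V} (hJ : IsBigrading W F J) (hC : DeligneCongr c J) (p q : ℤ) :
    J (p, q) = deligneI c W F p q := by
  refine le_antisymm (le_deligneI h hJ hC p q) fun x hx => ?_
  have htop := hJ.1.submodule_iSup_eq_top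
  have hx' : x ∈ J (p, q) ⊔ ⨆ rs : ℤ × ℤ, ⨆ _ : rs ≠ (p, q), deligneI c W F rs.1 rs.2 := by
    refine (?_ : (⊤ : Submodule ℂ V) ≤ _) Submodule.mem_top
    rw [← htop]
    refine iSup_le fun rs => ?_
    by_cases hrs : rs = (p, q)
    · rw [hrs]; exact le_sup_left
    · exact le_trans (le_iSup₂_of_le rs hrs (le_deligneI h hJ hC rs.1 rs.2)) le_sup_right
  obtain ⟨a, ha, b, hb, rfl⟩ := Submodule.mem_sup.1 hx'
  have hbI : b ∈ deligneI c W F p q := by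
    have := Submodule.sub_mem _ hx (le_deligneI h hJ hC p q ha)
    simpa using this
  have hb0 := Submodule.disjoint_def.1 (indep h (p, q)) b hbI hb
  rw [hb0, add_zero]; exact ha

end DeligneAux

/-- every real mixed Hodge structure admits a unique bigrading
`{I^{p,q}}` satisfying Deligne's congruence condition, and this bigrading is
given by Deligne's explicit formula. -/
theorem deligne_bigrading_exists_unique
    [FiniteDimensional ℂ V] (c : ConjOp V) (W F : ℤ → Submodule ℂ V)
    (hmhs : IsMHS c W F) :
    (∃! J : ℤ × ℤ → Submodule ℂ V, IsBigrading W F J ∧ DeligneCongr c J) ∧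
      (∀ J : ℤ × ℤ → Submodule ℂ V, IsBigrading W F J → DeligneCongr c J →
        ∀ p q : ℤ, J (p, q) = deligneI c W F p q) := by
  exact ⟨⟨fun rs => deligneI c W F rs.1 rs.2,
      ⟨DeligneAux.bigrading hmhs, DeligneAux.congr hmhs⟩,
      fun J hJ => funext fun rs => DeligneAux.eq_deligneI hmhs hJ.1 hJ.2 rs.1 rs.2⟩,
    fun J hJ hC p q => DeligneAux.eq_deligneI hmhs hJ hC p q⟩
end
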